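/- For each n ≥ 1, lim_{α → -∞} c_n(α) = lim_{α → +∞} c_n(α) = 0, where c_n(α) = u_n(α)/l_n(α) = (B_α A^{-1})^n(0); the continuous extension of c_n to a self-map of S¹ (via the Cayley transform, sending ∞ ↦ 0) is an n-fold covering map of S¹, i.e., has winding number n. -/

import Mathlib

open Matrix OnePoint

noncomputable abbrev SL2 := Matrix.SpecialLinearGroup (Fin 2) ℝ

noncomputable def mobius (g : SL2) : OnePoint ℝ → OnePoint ℝ :=
  fun p => Option.elim p
    (if g.1 1 0 = 0 then ∞ else ((g.1 0 0 / g.1 1 0 : ℝ) : OnePoint ℝ))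
    (fun x => if g.1 1 0 * x + g.1 1 1 = 0 then ∞
      else (((g.1 0 0 * x + g.1 0 1) / (g.1 1 0 * x + g.1 1 1) : ℝ) : OnePoint ℝ))

noncomputable def matA : SL2 := ⟨!![1,1;0,1], by norm_num [Matrix.det_fin_two_of]⟩
noncomputable def matB (α : ℝ) : SL2 := ⟨!![1,0;α,1], by norm_num [Matrix.det_fin_two_of]⟩

def IncAt (I : Set ℝ) (f : ℝ → OnePoint ℝ) (a : ℝ) : Prop :=
  ∃ ε > 0, Set.Ioo (a - ε) (a + ε) ⊆ I ∧
    ∀ x ∈ Set.Ioo (a - ε) (a + ε), ∀ y ∈ Set.Ioo (a - ε) (a + ε), x < y →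
      ∃ rx ry : ℝ, f x = (rx : OnePoint ℝ) ∧ f y = (ry : OnePoint ℝ) ∧ rx < ry

def DecAt (I : Set ℝ) (f : ℝ → OnePoint ℝ) (a : ℝ) : Prop :=
  ∃ ε > 0, Set.Ioo (a - ε) (a + ε) ⊆ I ∧
    ∀ x ∈ Set.Ioo (a - ε) (a + ε), ∀ y ∈ Set.Ioo (a - ε) (a + ε), x < y →
      ∃ rx ry : ℝ, f x = (rx : OnePoint ℝ) ∧ f y = (ry : OnePoint ℝ) ∧ ry < rx

noncomputable def negInv (p : OnePoint ℝ) : OnePoint ℝ :=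
  Option.elim p (((0 : ℝ) : OnePoint ℝ))
    (fun x => if x = 0 then ∞ else ((-1 / x : ℝ) : OnePoint ℝ))

def AnticlockwiseAt (I : Set ℝ) (f : ℝ → OnePoint ℝ) (a : ℝ) : Prop :=
  IncAt I f a ∨ IncAt I (fun x => negInv (f x)) a

def ClockwiseAt (I : Set ℝ) (f : ℝ → OnePoint ℝ) (a : ℝ) : Prop :=
  DecAt I f a ∨ DecAt I (fun x => negInv (f x)) a

noncomputable def addPt (p : OnePoint ℝ) (c : ℝ) : OnePoint ℝ :=
  Option.elim p ∞ (fun r => ((r + c : ℝ) : OnePoint ℝ))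

noncomputable def oinv (p : OnePoint ℝ) : OnePoint ℝ :=
  Option.elim p (((0 : ℝ) : OnePoint ℝ))
    (fun x => if x = 0 then ∞ else ((1 / x : ℝ) : OnePoint ℝ))

noncomputable def cmap (n : ℕ) (α : ℝ) : OnePoint ℝ :=
  mobius ((matB α * matA⁻¹) ^ n) ((0 : ℝ) : OnePoint ℝ)

noncomputable def cext (n : ℕ) : OnePoint ℝ → OnePoint ℝ :=
  fun p => Option.elim p (((0 : ℝ) : OnePoint ℝ)) (cmap n)

open Polynomial Topology Filter

/-- The point of the projective line with homogeneous coordinates `[p : q]`. -/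
noncomputable def ratioPt (p q : ℝ) : OnePoint ℝ :=
  if q = 0 then ∞ else ((p / q : ℝ) : OnePoint ℝ)

lemma ratioPt_of_ne {p q : ℝ} (hq : q ≠ 0) : ratioPt p q = ((p / q : ℝ) : OnePoint ℝ) :=
  if_neg hq

lemma ratioPt_mul_left {c : ℝ} (hc : c ≠ 0) (p q : ℝ) :
    ratioPt (c * p) (c * q) = ratioPt p q := by
  simp [ratioPt, hc, mul_div_mul_left]

lemma ratioPt_eq_zero_iff {p q : ℝ} (h : p ≠ 0 ∨ q ≠ 0) :
    ratioPt p q = ((0 : ℝ) : OnePoint ℝ) ↔ p = 0 := by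
  by_cases hq : q = 0
  · simp_all [ratioPt]
  · rw [ratioPt_of_ne hq, OnePoint.coe_eq_coe, div_eq_zero_iff]
    simp [hq]

lemma oinv_coe (x : ℝ) : oinv x = ratioPt 1 x := rfl

lemma oinv_coe_of_ne {x : ℝ} (hx : x ≠ 0) : oinv x = ((x⁻¹ : ℝ) : OnePoint ℝ) := by
  rw [oinv_coe, ratioPt_of_ne hx, one_div]

lemma oinv_coe_zero : oinv ((0 : ℝ) : OnePoint ℝ) = ∞ := if_pos rfl

lemma oinv_infty : oinv ∞ = ((0 : ℝ) : OnePoint ℝ) := rfl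

lemma oinv_ratioPt {p q : ℝ} (h : p ≠ 0 ∨ q ≠ 0) : oinv (ratioPt q p) = ratioPt p q := by
  by_cases hp : p = 0
  · have hq : q ≠ 0 := by tauto
    simp [ratioPt, hp, hq, oinv_infty]
  · rw [ratioPt_of_ne hp, oinv_coe, ← ratioPt_mul_left hp, mul_one, mul_div_cancel₀ _ hp]

lemma oinv_involutive : Function.Involutive oinv := by
  intro x
  cases x with
  | infty => rw [oinv_infty, oinv_coe_zero]
  | coe x => rw [oinv_coe, oinv_ratioPt (Or.inr one_ne_zero), ratioPt_of_ne one_ne_zero, div_one]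

lemma continuous_oinv : Continuous oinv := by
  rw [continuous_iff_continuousAt]
  intro x
  cases x with
  | infty =>
    rw [OnePoint.continuousAt_infty', coclosedCompact_eq_cocompact,
      ← Metric.cobounded_eq_cocompact, oinv_infty]
    refine ((OnePoint.continuous_coe.tendsto (0 : ℝ)).comp
      (tendsto_inv₀_cobounded (α := ℝ))).congr' ?_
    filter_upwards [Bornology.eventually_ne_cobounded (0 : ℝ)] with x hx
    exact (oinv_coe_of_ne hx).symm
  | coe x =>
    rw [OnePoint.continuousAt_coe]
    by_cases hx : x = 0
    · subst hx
      rw [continuousAt_iff_punctured_nhds, Function.comp_apply, oinv_coe_zero]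
      have h : Tendsto (fun x : ℝ => ((x⁻¹ : ℝ) : OnePoint ℝ)) (𝓝[≠] 0) (𝓝 ∞) := by
        refine OnePoint.tendsto_coe_infty.comp ?_
        rw [coclosedCompact_eq_cocompact, ← Metric.cobounded_eq_cocompact]
        exact tendsto_inv₀_nhdsNE_zero
      refine h.congr' ?_
      filter_upwards [self_mem_nhdsWithin] with x hx
      exact (oinv_coe_of_ne hx).symm
    · refine ContinuousAt.congr
        (OnePoint.continuous_coe.continuousAt.comp (continuousAt_inv₀ hx)) ?_
      filter_upwards [isOpen_ne.mem_nhds hx] with y hy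
      exact (oinv_coe_of_ne hy).symm

/-- Inversion as a self-homeomorphism of the projective line. -/
noncomputable def oinvHomeomorph : OnePoint ℝ ≃ₜ OnePoint ℝ where
  toEquiv := oinv_involutive.toPerm
  continuous_toFun := continuous_oinv
  continuous_invFun := continuous_oinv

lemma isLocalHomeomorph_oinv : IsLocalHomeomorph oinv :=
  oinvHomeomorph.isLocalHomeomorph

lemma IsLocalHomeomorphOn.congr_singleton {X Y : Type*} [TopologicalSpace X] [TopologicalSpace Y]
    {f g : X → Y} {x : X} (hg : IsLocalHomeomorphOn g {x}) (hfg : f =ᶠ[𝓝 x] g) :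
    IsLocalHomeomorphOn f {x} := by
  refine IsLocalHomeomorphOn.mk _ _ fun y hy => ?_
  obtain rfl : y = x := hy
  obtain ⟨e, he, rfl⟩ := hg y rfl
  obtain ⟨t, ht, hto, hyt⟩ := eventually_nhds_iff.1 hfg
  refine ⟨e.restrOpen t hto, ⟨he, hyt⟩, fun z hz => ht z hz.2⟩

lemma isLocalHomeomorphOn_singleton_of_hasStrictDerivAt {f : ℝ → ℝ} {f' x : ℝ}
    (hf : HasStrictDerivAt f f' x) (hf' : f' ≠ 0) : IsLocalHomeomorphOn f {x} := by
  rintro y rfl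
  exact ⟨(hf.hasStrictFDerivAt_equiv hf').toOpenPartialHomeomorph f,
    (hf.hasStrictFDerivAt_equiv hf').mem_toOpenPartialHomeomorph_source, rfl⟩

/-- A projective curve with nonvanishing Wronskian and nonzero second coordinate is a local
homeomorphism. -/
lemma isLocalHomeomorphOn_ratioPt_of_ne {p q : ℝ → ℝ} {p' q' x : ℝ}
    (hp : HasStrictDerivAt p p' x) (hq : HasStrictDerivAt q q' x)
    (hW : p' * q x - p x * q' ≠ 0) (hqx : q x ≠ 0) :
    IsLocalHomeomorphOn (fun y => ratioPt (p y) (q y)) {x} := by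
  have h1 : IsLocalHomeomorphOn (fun y => p y / q y) {x} :=
    isLocalHomeomorphOn_singleton_of_hasStrictDerivAt (hp.div hq hqx)
      (div_ne_zero hW (pow_ne_zero 2 hqx))
  refine (OnePoint.isOpenEmbedding_coe.isLocalHomeomorph.isLocalHomeomorphOn.comp h1
    (Set.mapsTo_univ _ _)).congr_singleton ?_
  filter_upwards [hq.hasDerivAt.continuousAt.eventually_ne hqx] with y hy
  exact ratioPt_of_ne hy

/-- A projective curve with nonvanishing Wronskian is a local homeomorphism. -/
lemma isLocalHomeomorphOn_ratioPt {p q : ℝ → ℝ} {p' q' x : ℝ}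
    (hp : HasStrictDerivAt p p' x) (hq : HasStrictDerivAt q q' x)
    (hW : p' * q x - p x * q' ≠ 0) :
    IsLocalHomeomorphOn (fun y => ratioPt (p y) (q y)) {x} := by
  by_cases hqx : q x = 0
  · have hpx : p x ≠ 0 := fun h => hW (by simp [h, hqx])
    have hW' : q' * p x - q x * p' ≠ 0 := fun h => hW (by linear_combination -h)
    refine (isLocalHomeomorph_oinv.isLocalHomeomorphOn.comp
      (isLocalHomeomorphOn_ratioPt_of_ne hq hp hW' hpx)
      (Set.mapsTo_univ _ _)).congr_singleton ?_
    filter_upwards [hp.hasDerivAt.continuousAt.eventually_ne hpx] with y hy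
    exact (oinv_ratioPt (Or.inl hy)).symm
  · exact isLocalHomeomorphOn_ratioPt_of_ne hp hq hW hqx

/-- The second column `(uₙ, lₙ)` of `(B_α A⁻¹) ^ n`, as polynomials in `α`. -/
noncomputable def orbitPoly : ℕ → ℝ[X] × ℝ[X]
  | 0 => (0, 1)
  | n + 1 => ((orbitPoly n).1 - (orbitPoly n).2,
      X * ((orbitPoly n).1 - (orbitPoly n).2) + (orbitPoly n).2)

/-- The polynomials `t ^ n * uₙ (1 / t)` and `t ^ n * lₙ (1 / t)`. -/
noncomputable def orbitPolyRev : ℕ → ℝ[X] × ℝ[X]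
  | 0 => (0, 1)
  | n + 1 => (X * ((orbitPolyRev n).1 - (orbitPolyRev n).2),
      (orbitPolyRev n).1 - (orbitPolyRev n).2 + X * (orbitPolyRev n).2)

lemma cmap_eq_ratioPt (n : ℕ) (α : ℝ) :
    cmap n α = ratioPt ((orbitPoly n).1.eval α) ((orbitPoly n).2.eval α) := by
  have h : ((matB α * matA⁻¹) ^ n).1 0 1 = (orbitPoly n).1.eval α ∧
      ((matB α * matA⁻¹) ^ n).1 1 1 = (orbitPoly n).2.eval α := by
    induction n with
    | zero => simp [orbitPoly]
    | succ n ih =>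
      obtain ⟨h1, h2⟩ := ih
      have hM : (matB α * matA⁻¹).1 = !![1, -1; α, 1 - α] := by
        rw [Matrix.SpecialLinearGroup.coe_mul, Matrix.SpecialLinearGroup.coe_inv]
        simp [matA, matB, Matrix.adjugate_fin_two_of, sub_eq_neg_add]
      have hS : ((matB α * matA⁻¹) ^ (n + 1)).1 =
          (matB α * matA⁻¹).1 * ((matB α * matA⁻¹) ^ n).1 := by
        rw [pow_succ']; rfl
      rw [hS, hM, Matrix.mul_apply, Matrix.mul_apply, Fin.sum_univ_two, Fin.sum_univ_two, h1, h2]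
      simp only [orbitPoly, eval_sub, eval_add, eval_mul, eval_X]
      constructor <;> simp <;> ring
  change ratioPt _ _ = _ at *
  simp only [mul_zero, zero_add, h.1, h.2]

lemma orbitPolyRev_eval (n : ℕ) {t : ℝ} (ht : t ≠ 0) :
    (orbitPolyRev n).1.eval t = t ^ n * (orbitPoly n).1.eval t⁻¹ ∧
    (orbitPolyRev n).2.eval t = t ^ n * (orbitPoly n).2.eval t⁻¹ := by
  induction n with
  | zero => simp [orbitPoly, orbitPolyRev]
  | succ n ih =>
    simp only [orbitPoly, orbitPolyRev, eval_sub, eval_add, eval_mul, eval_X, ih.1, ih.2]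
    constructor
    · ring
    · field_simp
      ring

lemma orbitPolyRev_fst_eval_zero (n : ℕ) : (orbitPolyRev n).1.eval 0 = 0 := by
  cases n <;> simp [orbitPolyRev]

lemma orbitPolyRev_snd_eval_zero_ne (n : ℕ) : (orbitPolyRev n).2.eval 0 ≠ 0 := by
  induction n with
  | zero => simp [orbitPolyRev]
  | succ n ih => simpa [orbitPolyRev, orbitPolyRev_fst_eval_zero] using ih

lemma orbitPolyRev_fst_derivative_eval_zero_ne {n : ℕ} (hn : 1 ≤ n) :
    (orbitPolyRev n).1.derivative.eval 0 ≠ 0 := by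
  obtain ⟨n, rfl⟩ := Nat.exists_eq_add_of_le' hn
  simpa [orbitPolyRev, orbitPolyRev_fst_eval_zero] using orbitPolyRev_snd_eval_zero_ne n

lemma orbitPoly_wronskian_succ (n : ℕ) :
    (orbitPoly (n + 1)).1.derivative * (orbitPoly (n + 1)).2
        - (orbitPoly (n + 1)).1 * (orbitPoly (n + 1)).2.derivative =
      (orbitPoly n).1.derivative * (orbitPoly n).2 - (orbitPoly n).1 * (orbitPoly n).2.derivative
        - (orbitPoly (n + 1)).1 ^ 2 := by
  simp only [orbitPoly, derivative_add, derivative_sub, derivative_mul, derivative_X]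
  ring

lemma orbitPoly_wronskian_neg {n : ℕ} (hn : 1 ≤ n) (α : ℝ) :
    (orbitPoly n).1.derivative.eval α * (orbitPoly n).2.eval α
      - (orbitPoly n).1.eval α * (orbitPoly n).2.derivative.eval α < 0 := by
  induction n, hn using Nat.le_induction with
  | base => simp [orbitPoly]
  | succ n _ ih =>
    have h := congrArg (eval α) (orbitPoly_wronskian_succ n)
    simp only [eval_sub, eval_mul, eval_pow] at h
    nlinarith [sq_nonneg ((orbitPoly (n + 1)).1.eval α)]

lemma orbitPoly_eval_ne_zero {n : ℕ} (hn : 1 ≤ n) (α : ℝ) :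
    (orbitPoly n).1.eval α ≠ 0 ∨ (orbitPoly n).2.eval α ≠ 0 := by
  by_contra! h
  simpa [h.1, h.2] using orbitPoly_wronskian_neg hn α

lemma orbitPoly_fst_add_two (n : ℕ) :
    (orbitPoly (n + 2)).1 = (2 - X) * (orbitPoly (n + 1)).1 - (orbitPoly n).1 := by
  simp only [orbitPoly]
  ring

lemma orbitPoly_fst_eval (n : ℕ) (x : ℝ) :
    (orbitPoly (n + 1)).1.eval (2 - 2 * x) = -(Chebyshev.U ℝ n).eval x := by
  induction n using Nat.twoStepInduction with
  | zero => simp [orbitPoly]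
  | one => simp [orbitPoly]; ring
  | more n ih1 ih2 =>
    rw [orbitPoly_fst_add_two (n + 1)]
    have h := Chebyshev.U_add_two ℝ (n : ℤ)
    push_cast at ih1 ih2 h ⊢
    rw [h]
    simp only [eval_sub, eval_mul, eval_X, eval_ofNat, ih1, ih2]
    ring

lemma card_orbitPoly_fst_zeros (n : ℕ) :
    {α : ℝ | (orbitPoly (n + 1)).1.eval α = 0}.ncard = n := by
  have hroot (x : ℝ) : x ∈ (Finset.range n).image
      (fun k : ℕ => Real.cos ((k + 1) * Real.pi / (n + 1))) ↔ (Chebyshev.U ℝ n).eval x = 0 := by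
    have h0 : Chebyshev.U ℝ n ≠ 0 := fun h => by
      simpa [h] using Chebyshev.degree_U_natCast ℝ n
    rw [← Finset.mem_val, ← Chebyshev.roots_U_real, mem_roots h0, IsRoot.def]
  have himage : {α : ℝ | (orbitPoly (n + 1)).1.eval α = 0} =
      (fun x : ℝ => 2 - 2 * x) '' ((Finset.range n).image
        (fun k : ℕ => Real.cos ((k + 1) * Real.pi / (n + 1)))) := by
    ext α
    simp only [Set.mem_ofPred_eq, Set.mem_image, Finset.mem_coe, hroot]
    constructor
    · intro h
      refine ⟨(2 - α) / 2, ?_, by ring⟩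
      rw [← neg_eq_zero, ← orbitPoly_fst_eval, ← h]
      congr 1
      ring
    · rintro ⟨x, hx, rfl⟩
      rw [orbitPoly_fst_eval, hx, neg_zero]
  have hinj : Function.Injective fun x : ℝ => 2 - 2 * x := fun x y h => by
    simpa using h
  rw [himage, Set.ncard_image_of_injective _ hinj, Set.ncard_coe_finset,
    Finset.card_image_of_injOn ((Finset.range n).nodup_map_iff_injOn.mp
      (Chebyshev.roots_U_real_nodup n)), Finset.card_range]

lemma cext_coe (n : ℕ) (α : ℝ) : cext n α = cmap n α := rfl

lemma cext_oinv_coe (n : ℕ) (t : ℝ) :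
    cext n (oinv t) = ratioPt ((orbitPolyRev n).1.eval t) ((orbitPolyRev n).2.eval t) := by
  by_cases ht : t = 0
  · subst ht
    rw [oinv_coe_zero, ratioPt_of_ne (orbitPolyRev_snd_eval_zero_ne n),
      orbitPolyRev_fst_eval_zero, zero_div]
    rfl
  · rw [oinv_coe_of_ne ht, cext_coe, cmap_eq_ratioPt, (orbitPolyRev_eval n ht).1,
      (orbitPolyRev_eval n ht).2, ratioPt_mul_left (pow_ne_zero n ht)]

lemma isLocalHomeomorph_cext {n : ℕ} (hn : 1 ≤ n) : IsLocalHomeomorph (cext n) := by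
  have hfin (α : ℝ) : IsLocalHomeomorphOn (cext n) ((↑) '' ({α} : Set ℝ)) := by
    refine IsLocalHomeomorphOn.of_comp_right ?_
      OnePoint.isOpenEmbedding_coe.isLocalHomeomorph.isLocalHomeomorphOn
    have h : cext n ∘ ((↑) : ℝ → OnePoint ℝ) =
        fun α => ratioPt ((orbitPoly n).1.eval α) ((orbitPoly n).2.eval α) :=
      funext (cmap_eq_ratioPt n)
    rw [h]
    exact isLocalHomeomorphOn_ratioPt ((orbitPoly n).1.hasStrictDerivAt α)
      ((orbitPoly n).2.hasStrictDerivAt α) (orbitPoly_wronskian_neg hn α).ne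
  have hinf : IsLocalHomeomorphOn (cext n) ((oinv ∘ (↑)) '' ({0} : Set ℝ)) := by
    refine IsLocalHomeomorphOn.of_comp_right ?_ (isLocalHomeomorph_oinv.comp
      OnePoint.isOpenEmbedding_coe.isLocalHomeomorph).isLocalHomeomorphOn
    have h : cext n ∘ oinv ∘ ((↑) : ℝ → OnePoint ℝ) =
        fun t => ratioPt ((orbitPolyRev n).1.eval t) ((orbitPolyRev n).2.eval t) :=
      funext (cext_oinv_coe n)
    rw [h]
    refine isLocalHomeomorphOn_ratioPt ((orbitPolyRev n).1.hasStrictDerivAt 0)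
      ((orbitPolyRev n).2.hasStrictDerivAt 0) ?_
    rw [orbitPolyRev_fst_eval_zero, zero_mul, sub_zero]
    exact mul_ne_zero (orbitPolyRev_fst_derivative_eval_zero_ne hn)
      (orbitPolyRev_snd_eval_zero_ne n)
  intro x
  cases x with
  | infty => exact hinf ∞ ⟨0, rfl, oinv_coe_zero⟩
  | coe α => exact hfin α α ⟨α, rfl, rfl⟩

lemma IsCoveringMap.card_fiber_eq {E X : Type*} [TopologicalSpace E] [TopologicalSpace X]
    [PreconnectedSpace X] {f : E → X} (hf : IsCoveringMap f) (x y : X) :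
    Nat.card (f ⁻¹' {x}) = Nat.card (f ⁻¹' {y}) := by
  have h : IsLocallyConstant fun x => Nat.card (f ⁻¹' {x}) := by
    rw [IsLocallyConstant.iff_exists_open]
    intro x
    obtain ⟨hI, U, hxU, hU, hfU, H, hH⟩ := hf x
    refine ⟨U, hU, hxU, fun y hy => ?_⟩
    have hy' : IsEvenlyCovered f y (f ⁻¹' {x}) := ⟨hI, U, hy, hU, hfU, H, hH⟩
    exact (Nat.card_congr hy'.fiberHomeomorph.toEquiv).symm
  exact h.apply_eq_of_preconnectedSpace x y

lemma card_cext_fiber_zero {n : ℕ} (hn : 1 ≤ n) :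
    Nat.card (cext n ⁻¹' {((0 : ℝ) : OnePoint ℝ)}) = n := by
  have hset : cext n ⁻¹' {((0 : ℝ) : OnePoint ℝ)} =
      insert ∞ ((↑) '' {α : ℝ | (orbitPoly n).1.eval α = 0}) := by
    ext x
    cases x with
    | infty => exact iff_of_true rfl (Set.mem_insert _ _)
    | coe α =>
      rw [Set.mem_preimage, Set.mem_singleton_iff, cext_coe, cmap_eq_ratioPt,
        ratioPt_eq_zero_iff (orbitPoly_eval_ne_zero hn α)]
      simp
  obtain ⟨m, rfl⟩ := Nat.exists_eq_add_of_le' hn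
  have hne : (orbitPoly (m + 1)).1 ≠ 0 := fun h => by
    simpa [h] using orbitPoly_wronskian_neg hn 0
  have hfin : {α : ℝ | (orbitPoly (m + 1)).1.eval α = 0}.Finite :=
    finite_setOfPred_isRoot hne
  rw [Nat.card_coe_set_eq, hset,
    Set.ncard_insert_of_notMem OnePoint.infty_notMem_image_coe (hfin.image _),
    Set.ncard_image_of_injective _ OnePoint.coe_injective, card_orbitPoly_fst_zeros]

theorem stmt17 (n : ℕ) (hn : 1 ≤ n) :
    Filter.Tendsto (cmap n) Filter.atBot (nhds (((0 : ℝ) : OnePoint ℝ))) ∧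
    Filter.Tendsto (cmap n) Filter.atTop (nhds (((0 : ℝ) : OnePoint ℝ))) ∧
    IsCoveringMap (cext n) ∧
    ∀ y : OnePoint ℝ, Nat.card ((cext n) ⁻¹' {y}) = n := by
  have hloc := isLocalHomeomorph_cext hn
  have hcov : IsCoveringMap (cext n) := isLocalHomeomorph_iff_isCoveringMap.1 hloc
  have hlim : Tendsto (cmap n) (cocompact ℝ) (𝓝 ((0 : ℝ) : OnePoint ℝ)) := by
    rw [← coclosedCompact_eq_cocompact]
    exact (hloc.continuous.tendsto ∞).comp OnePoint.tendsto_coe_infty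
  exact ⟨hlim.mono_left atBot_le_cocompact, hlim.mono_left atTop_le_cocompact, hcov,
    fun y => (hcov.card_fiber_eq y _).trans (card_cext_fiber_zero hn)⟩
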